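/- arXiv:1802.03754 — 2 statements merged into one kernel-verified Lean document; each statement's English description precedes it below -/
import Mathlib

section
/- Let T be a finite tree rooted at a vertex r, let ρ : V(T) → ℤ, let u be a vertex of T with children v_1, …, v_k, and let D be a dynamic monopoly of (T_u, ρ|_{V_u}). Then for every i ∈ {1,…,k}, the set D ∩ V_{v_i} is a dynamic monopoly of (T_{v_i}, (ρ^{→v_i})|_{V_{v_i}}). Moreover, if u ∉ D and ρ(u) ≥ 1, then there exists ℓ ∈ {1,…,k} such that D ∩ V_{v_ℓ} is a dynamic monopoly of (T_{v_ℓ}, ρ|_{V_{v_ℓ}}). -/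
open scoped BigOperators Classical

/-- `H` is closed under the infection rule of `(G,ρ)` relative to the vertex set `A`:
every vertex `u ∈ A` with at least `ρ u` neighbors in `H` belongs to `H`. -/
def Closed {V : Type*} [Fintype V] (G : SimpleGraph V) (ρ : V → ℤ) (A H : Set V) : Prop :=
  ∀ u ∈ A, ρ u ≤ ((H ∩ G.neighborSet u).ncard : ℤ) → u ∈ H

/-- `D` is a dynamic monopoly of the subgraph of `G` induced by `A` with thresholds `ρ`:
`D ⊆ A` and the smallest closed set containing `D` is all of `A`. -/
def IsDynMonoOn {V : Type*} [Fintype V] (G : SimpleGraph V) (ρ : V → ℤ) (A D : Set V) : Prop :=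
  D ⊆ A ∧ ∀ H : Set V, D ⊆ H → H ⊆ A → Closed G ρ A H → A ⊆ H

/-- the minimum cardinality of a dynamic monopoly of the subgraph of `G` induced by `A` -/
noncomputable def dynOn {V : Type*} [Fintype V] (G : SimpleGraph V) (ρ : V → ℤ) (A : Set V) : ℕ :=
  sInf {n | ∃ D : Set V, IsDynMonoOn G ρ A D ∧ D.ncard = n}

/-- the minimum cardinality of a dynamic monopoly of `(G,ρ)` -/
noncomputable def dyn {V : Type*} [Fintype V] (G : SimpleGraph V) (ρ : V → ℤ) : ℕ :=
  dynOn G ρ Set.univ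

/-- the set consisting of `u` and its descendants in the tree `T` rooted at `r`:
the vertices `v` such that every path from `r` to `v` passes through `u` -/
def descSet {V : Type*} (T : SimpleGraph V) (r u : V) : Set V :=
  {v | ∀ p : T.Walk r v, p.IsPath → u ∈ p.support}

/-- the sum `∑_{v ∈ s} f v` -/
noncomputable def setSum {V : Type*} [Fintype V] (s : Set V) (f : V → ℤ) : ℤ :=
  ∑ v, s.indicator f v

/-- For `j ∈ {0,1}`, `xval T r τ ιmax j u b` is the maximum of
`dyn (T_u, ((τ+ι)^{→u applied j times})|_{V_u})` over all increments `ι` with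
`0 ≤ ι ≤ ιmax` on `V_u` and `∑_{v ∈ V_u} ι v = b`. -/
noncomputable def xval {V : Type*} [Fintype V] [DecidableEq V] (T : SimpleGraph V) (r : V)
    (τ ιmax : V → ℤ) (j : ℤ) (u : V) (b : ℤ) : ℕ :=
  sSup {n | ∃ ι : V → ℤ, (∀ v ∈ descSet T r u, 0 ≤ ι v ∧ ι v ≤ ιmax v) ∧
    setSum (descSet T r u) ι = b ∧
    n = dynOn T (fun v => τ v + ι v - if v = u then j else 0) (descSet T r u)}

def Par {V : Type*} (T : SimpleGraph V) (r p y : V) : Prop :=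
  T.Adj p y ∧ p ∉ descSet T r y ∧ ∀ a, y ∈ descSet T r a ↔ (a = y ∨ p ∈ descSet T r a)

lemma mem_desc_iff {V : Type*} {T : SimpleGraph V} (hT : T.IsTree) {r y a : V}
    (p : T.Walk r y) (hp : p.IsPath) : y ∈ descSet T r a ↔ a ∈ p.support := by
  constructor
  · intro h
    exact h p hp
  · intro h q hq
    have := hT.isAcyclic.path_unique ⟨p, hp⟩ ⟨q, hq⟩
    have h2 : p = q := congrArg Subtype.val this
    rw [← h2]; exact h

lemma par_of_path {V : Type*} {T : SimpleGraph V} (hT : T.IsTree) {r x y : V}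
    (p : T.Walk r x) (hp : p.IsPath) (h : T.Adj x y) (hy : y ∉ p.support) : Par T r x y := by
  refine ⟨h, fun h' => hy ((mem_desc_iff hT p hp).1 h'), fun a => ?_⟩
  rw [mem_desc_iff hT _ (hp.concat hy h), mem_desc_iff hT p hp, SimpleGraph.Walk.support_concat]
  simp [or_comm]

lemma exists_path' {V : Type*} {T : SimpleGraph V} (hT : T.IsTree) (r y : V) :
    ∃ p : T.Walk r y, p.IsPath := by
  classical
  obtain ⟨p⟩ := hT.connected.preconnected r y
  exact ⟨p.toPath, p.toPath.2⟩

lemma par_or {V : Type*} {T : SimpleGraph V} (hT : T.IsTree) (r : V) {w x : V}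
    (h : T.Adj w x) : Par T r w x ∨ Par T r x w := by
  classical
  obtain ⟨p, hp⟩ := exists_path' hT r w
  by_cases hx : x ∈ p.support
  · right
    exact par_of_path hT (p.takeUntil x hx) (hp.takeUntil hx) h.symm
      (SimpleGraph.Walk.endpoint_notMem_support_takeUntil hp hx h.ne)
  · exact Or.inl (par_of_path hT p hp h hx)

lemma par_unique {V : Type*} {T : SimpleGraph V} (hT : T.IsTree) {r a b y : V}
    (ha : Par T r a y) (hb : Par T r b y) : a = b := by
  obtain ⟨p, hp⟩ := exists_path' hT r a
  obtain ⟨q, hq⟩ := exists_path' hT r b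
  have h1 := hp.concat (fun h => ha.2.1 ((mem_desc_iff hT p hp).2 h)) ha.1
  have h2 := hq.concat (fun h => hb.2.1 ((mem_desc_iff hT q hq).2 h)) hb.1
  have := congrArg Subtype.val (hT.isAcyclic.path_unique ⟨_, h1⟩ ⟨_, h2⟩)
  have := congrArg SimpleGraph.Walk.penultimate this
  simpa using this

lemma desc_root {V : Type*} {T : SimpleGraph V} {r a : V} (h : r ∈ descSet T r a) : a = r := by
  simpa using h SimpleGraph.Walk.nil SimpleGraph.Walk.IsPath.nil

lemma desc_self {V : Type*} {T : SimpleGraph V} {r a : V} : a ∈ descSet T r a :=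
  fun p _ => p.end_mem_support

lemma tree_induct {V : Type*} {T : SimpleGraph V} (hT : T.IsTree) (r : V) (M : V → Prop)
    (h0 : M r) (hs : ∀ p y, Par T r p y → M p → M y) (y : V) : M y := by
  classical
  have key : ∀ n : ℕ, ∀ y (p : T.Walk r y), p.IsPath → p.length = n → M y := by
    intro n
    induction n with
    | zero =>
      intro y p _ hl
      rw [← SimpleGraph.Walk.eq_of_length_eq_zero hl]; exact h0
    | succ n ih =>
      intro y p hp hl
      have hnn : ¬ p.Nil := by
        intro h
        have := SimpleGraph.Walk.nil_iff_length_eq.1 h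
        omega
      have hadj := p.adj_penultimate hnn
      have hmem : p.penultimate ∈ p.support := p.getVert_mem_support _
      have hpar := par_of_path hT (p.takeUntil _ hmem) (hp.takeUntil hmem) hadj
        (SimpleGraph.Walk.endpoint_notMem_support_takeUntil hp hmem hadj.ne')
      refine hs _ _ hpar (ih _ p.dropLast hp.dropLast ?_)
      simp [hl]
  obtain ⟨p, hp⟩ := exists_path' hT r y
  exact key _ y p hp rfl

lemma desc_trans {V : Type*} {T : SimpleGraph V} (hT : T.IsTree) {r a b y : V}
    (h1 : y ∈ descSet T r b) (h2 : b ∈ descSet T r a) : y ∈ descSet T r a := by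
  classical
  obtain ⟨p, hp⟩ := exists_path' hT r y
  have hb := h1 p hp
  have := h2 _ (hp.takeUntil hb)
  exact (mem_desc_iff hT p hp).2 (p.support_takeUntil_subset_support hb this)

/-- If `D` is a dynamic monopoly of `(T_u, ρ|_{V_u})` and `v 0, …, v (k-1)` are the
children of `u`, then `D ∩ V_{v i}` is a dynamic monopoly of
`(T_{v i}, (ρ^{→ v i})|_{V_{v i}})` for every `i`; moreover, if `u ∉ D` and
`ρ(u) ≥ 1`, then `D ∩ V_{v ℓ}` is a dynamic monopoly of `(T_{v ℓ}, ρ|_{V_{v ℓ}})`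
for some `ℓ`. -/
theorem monopoly_restrict_children {V : Type*} [Fintype V] [DecidableEq V]
    (T : SimpleGraph V) (hT : T.IsTree) (r : V) (ρ : V → ℤ) (u : V)
    (k : ℕ) (v : Fin k → V) (hinj : Function.Injective v)
    (hchild : ∀ w : V, (T.Adj u w ∧ w ∈ descSet T r u) ↔ ∃ i, v i = w)
    (D : Set V) (hD : IsDynMonoOn T ρ (descSet T r u) D) :
    (∀ i : Fin k, IsDynMonoOn T (fun w => ρ w - if w = v i then 1 else 0)
        (descSet T r (v i)) (D ∩ descSet T r (v i))) ∧
    (u ∉ D → 1 ≤ ρ u → ∃ ℓ : Fin k,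
        IsDynMonoOn T ρ (descSet T r (v ℓ)) (D ∩ descSet T r (v ℓ))) := by
  have hpar : ∀ i, Par T r u (v i) := by
    intro i
    obtain ⟨hadj, hd⟩ := (hchild (v i)).2 ⟨i, rfl⟩
    rcases par_or hT r hadj with h | h
    · exact h
    · exact absurd hd h.2.1
  have hsub : ∀ i, descSet T r (v i) ⊆ descSet T r u := fun i y hy =>
    desc_trans hT hy ((hchild (v i)).2 ⟨i, rfl⟩).2
  have hedge : ∀ i w x, T.Adj w x → w ∈ descSet T r (v i) → x ∉ descSet T r (v i) →
      w = v i ∧ x = u := by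
    intro i w x h hw hx
    rcases par_or hT r h with h | h
    · exact absurd (((h.2.2 _).2 (Or.inr hw))) hx
    · rcases (h.2.2 _).1 hw with h' | h'
      · subst h'
        exact ⟨rfl, par_unique hT h (hpar i)⟩
      · exact absurd h' hx
  have hcover : ∀ y, y ∈ descSet T r u → y ≠ u → ∃ i, y ∈ descSet T r (v i) := by
    intro y
    refine tree_induct hT r (fun y => y ∈ descSet T r u → y ≠ u → ∃ i, y ∈ descSet T r (v i))
      ?_ ?_ y
    · intro h hn
      exact absurd (desc_root h).symm hn
    · intro p y h ih hy hn
      by_cases hpu : p = u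
      · subst hpu
        obtain ⟨i, rfl⟩ := (hchild y).1 ⟨h.1, hy⟩
        exact ⟨i, desc_self⟩
      · rcases (h.2.2 _).1 hy with h' | h'
        · exact absurd h'.symm hn
        · obtain ⟨i, hi⟩ := ih h' hpu
          exact ⟨i, (h.2.2 _).2 (Or.inr hi)⟩
  have hroot : ∀ i j, v i ∈ descSet T r (v j) → j = i := by
    intro i j h
    rcases ((hpar i).2.2 _).1 h with h' | h'
    · exact hinj h'
    · exact absurd h' (hpar j).2.1
  have hdisj : ∀ i j y, y ∈ descSet T r (v i) → y ∈ descSet T r (v j) → i = j := by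
    intro i j y
    refine tree_induct hT r
      (fun y => y ∈ descSet T r (v i) → y ∈ descSet T r (v j) → i = j) ?_ ?_ y
    · intro h h'
      exact hinj ((desc_root h).trans (desc_root h').symm)
    · intro p y h ih h1 h2
      rcases (h.2.2 _).1 h1 with h' | h1'
      · subst h'
        exact (hroot _ _ h2).symm
      rcases (h.2.2 _).1 h2 with h' | h2'
      · subst h'
        exact hroot _ _ h1
      exact ih h1' h2'
  have part1 : ∀ i : Fin k, IsDynMonoOn T (fun w => ρ w - if w = v i then 1 else 0)
        (descSet T r (v i)) (D ∩ descSet T r (v i)) := by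
    intro i
    refine ⟨Set.inter_subset_right, fun H hDH hHA hcl => ?_⟩
    have := hD.2 (H ∪ (descSet T r u \ descSet T r (v i))) ?_ ?_ ?_
    · intro y hy
      rcases this (hsub i hy) with h | h
      · exact h
      · exact absurd hy h.2
    · intro y hy
      by_cases h : y ∈ descSet T r (v i)
      · exact Or.inl (hDH ⟨hy, h⟩)
      · exact Or.inr ⟨hD.1 hy, h⟩
    · exact Set.union_subset (hHA.trans (hsub i)) Set.diff_subset
    · intro w hw hle
      by_cases h : w ∈ descSet T r (v i)
      swap
      · exact Or.inr ⟨hw, h⟩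
      refine Or.inl (hcl w h ?_)
      by_cases hwv : w = v i
      · have hs : (H ∪ (descSet T r u \ descSet T r (v i))) ∩ T.neighborSet w ⊆
            insert u (H ∩ T.neighborSet w) := by
          rintro x ⟨hx | hx, hx'⟩
          · exact Or.inr ⟨hx, hx'⟩
          · exact Or.inl (hedge i w x hx' h hx.2).2
        have h1 := Set.ncard_le_ncard hs (Set.toFinite _)
        have h2 := Set.ncard_insert_le u (H ∩ T.neighborSet w)
        simp only [hwv, if_true] at *
        omega
      · have hs : (H ∪ (descSet T r u \ descSet T r (v i))) ∩ T.neighborSet w ⊆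
            (H ∩ T.neighborSet w) := by
          rintro x ⟨hx | hx, hx'⟩
          · exact ⟨hx, hx'⟩
          · exact absurd (hedge i w x hx' h hx.2).1 hwv
        have h1 := Set.ncard_le_ncard hs (Set.toFinite _)
        simp only [hwv, if_false]
        omega
  refine ⟨part1, fun hu hρ => ?_⟩
  by_contra hno
  have hex : ∀ i, ∃ H : Set V, D ∩ descSet T r (v i) ⊆ H ∧ H ⊆ descSet T r (v i) ∧
      Closed T ρ (descSet T r (v i)) H ∧ v i ∉ H := by
    intro i
    by_contra hcon
    apply hno
    refine ⟨i, Set.inter_subset_right, fun H h1 h2 h3 => ?_⟩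
    have hv : v i ∈ H := by
      by_contra hv
      exact hcon ⟨H, h1, h2, h3, hv⟩
    refine (part1 i).2 H h1 h2 ?_
    intro w hw hle
    by_cases hwv : w = v i
    · rw [hwv]; exact hv
    · simp only [hwv, if_false, sub_zero] at hle
      exact h3 w hw hle
  choose H h1 h2 h3 h4 using hex
  have := hD.2 (⋃ i, H i) ?_ ?_ ?_
  · obtain ⟨j, hj⟩ := Set.mem_iUnion.1 (this desc_self)
    exact (hpar j).2.1 (h2 j hj)
  · intro y hy
    obtain ⟨i, hi⟩ := hcover y (hD.1 hy) (fun h => hu (h ▸ hy))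
    exact Set.mem_iUnion.2 ⟨i, h1 i ⟨hy, hi⟩⟩
  · exact Set.iUnion_subset fun i => (h2 i).trans (hsub i)
  · intro w hw hle
    by_cases hwu : w = u
    · exfalso
      subst hwu
      have : (⋃ i, H i) ∩ T.neighborSet w = ∅ := by
        ext x
        simp only [Set.mem_inter_iff, Set.mem_iUnion, Set.mem_empty_iff_false, iff_false]
        rintro ⟨⟨j, hj⟩, hx⟩
        obtain ⟨i, rfl⟩ := (hchild x).1 ⟨hx, hsub j (h2 j hj)⟩
        have := hroot i j (h2 j hj)
        subst this
        exact h4 _ hj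
      rw [this] at hle
      simp at hle
      omega
    · obtain ⟨i, hi⟩ := hcover w hw hwu
      refine Set.mem_iUnion.2 ⟨i, h3 i w hi (hle.trans ?_)⟩
      have hs : (⋃ i, H i) ∩ T.neighborSet w ⊆ H i ∩ T.neighborSet w := by
        rintro x ⟨hx, hx'⟩
        obtain ⟨j, hj⟩ := Set.mem_iUnion.1 hx
        by_cases hxi : x ∈ descSet T r (v i)
        · have := hdisj i j x hxi (h2 j hj)
          subst this
          exact ⟨hj, hx'⟩
        · have := (hedge i w x hx' hi hxi).2
          subst this
          exact absurd (h2 j hj) (hpar j).2.1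
      exact_mod_cast Set.ncard_le_ncard hs (Set.toFinite _)
end

section
/- Let G be a finite simple r-regular graph, let b be a nonnegative integer, and let ι : V(G) → ℤ satisfy 0 ≤ ι(u) ≤ d_G(u) for every vertex u and Σ_{u∈V(G)} ι(u) = b. Then (r+1)·dyn(G, ι) ≤ b. -/
open scoped BigOperators Classical

noncomputable def dA {V : Type*} (G : SimpleGraph V) (A : Finset V) (u : V) : ℕ :=
  (A.filter (fun v => G.Adj u v)).card

noncomputable def fA {V : Type*} (G : SimpleGraph V) (ι : V → ℤ) (A : Finset V) (u : V) : ℚ :=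
  min 1 ((ι u : ℚ) / ((dA G A u : ℚ) + 1))

noncomputable def gA {V : Type*} (G : SimpleGraph V) (ι : V → ℤ) (A : Finset V) (u : V) : ℚ :=
  if ι u ≤ (dA G A u : ℤ) then 0 else 1

lemma vertex_bound {V : Type*} (G : SimpleGraph V) (ι : V → ℤ) (h0 : ∀ u, 0 ≤ ι u)
    (A : Finset V) (u : V) (hu : u ∈ A) :
    gA G ι A u + ∑ v ∈ A.erase u, fA G ι (A.erase v) u ≤ (A.card : ℚ) * fA G ι A u := by
  have hN : (A.erase u).filter (fun v => G.Adj u v) = A.filter (fun v => G.Adj u v) := by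
    ext v
    simp only [Finset.mem_filter, Finset.mem_erase]
    constructor
    · rintro ⟨⟨_, h⟩, h'⟩; exact ⟨h, h'⟩
    · rintro ⟨h, h'⟩; exact ⟨⟨h'.ne', h⟩, h'⟩
  have hcard : dA G A u + ((A.erase u).filter (fun v => ¬ G.Adj u v)).card + 1 = A.card := by
    have h1 := Finset.card_filter_add_card_filter_not (s := A.erase u) (fun v => G.Adj u v)
    rw [hN] at h1
    have h2 := Finset.card_erase_add_one hu
    unfold dA
    omega
  have hcQ : (A.card : ℚ) = dA G A u + ((A.erase u).filter (fun v => ¬ G.Adj u v)).card + 1 := by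
    exact_mod_cast hcard.symm
  have e1 : ∀ v ∈ (A.erase u).filter (fun v => G.Adj u v),
      fA G ι (A.erase v) u = min 1 ((ι u : ℚ) / (dA G A u : ℚ)) := by
    intro v hv
    have hv' : v ∈ A.filter (fun v => G.Adj u v) := hN ▸ hv
    have : dA G (A.erase v) u + 1 = dA G A u := by
      unfold dA
      rw [Finset.filter_erase, Finset.card_erase_add_one hv']
    unfold fA
    rw [← this]; push_cast; rfl
  have e2 : ∀ v ∈ (A.erase u).filter (fun v => ¬ G.Adj u v),
      fA G ι (A.erase v) u = fA G ι A u := by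
    intro v hv
    have : dA G (A.erase v) u = dA G A u := by
      unfold dA
      rw [Finset.filter_erase, Finset.erase_eq_of_notMem]
      simp only [Finset.mem_filter] at hv ⊢
      tauto
    unfold fA
    rw [this]
  rw [← Finset.sum_filter_add_sum_filter_not (A.erase u) (fun v => G.Adj u v),
    Finset.sum_congr rfl e1, Finset.sum_congr rfl e2, Finset.sum_const, Finset.sum_const, hN,
    nsmul_eq_mul, nsmul_eq_mul, hcQ]
  change gA G ι A u + ((dA G A u : ℚ) * _ + _) ≤ _
  have key : gA G ι A u + (dA G A u : ℚ) * min 1 ((ι u : ℚ) / (dA G A u : ℚ))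
      ≤ ((dA G A u : ℚ) + 1) * fA G ι A u := by
    have hd : (0 : ℚ) ≤ dA G A u := by positivity
    unfold gA fA
    split_ifs with h
    · have hq : (ι u : ℚ) ≤ dA G A u := by exact_mod_cast h
      rw [min_eq_right (a := (1 : ℚ)) (b := (ι u : ℚ) / ((dA G A u : ℚ) + 1))
        (by rw [div_le_one (by positivity)]; linarith),
        mul_div_cancel₀ _ (by positivity), zero_add]
      rcases hd.eq_or_lt with h' | h'
      · rw [← h', zero_mul]; exact_mod_cast h0 u
      · calc (dA G A u : ℚ) * min 1 ((ι u : ℚ) / (dA G A u : ℚ))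
            ≤ (dA G A u : ℚ) * ((ι u : ℚ) / (dA G A u : ℚ)) := by
              gcongr; exact min_le_right _ _
          _ = ι u := mul_div_cancel₀ _ h'.ne'
    · have hq : (dA G A u : ℚ) + 1 ≤ ι u := by
        have : (dA G A u : ℤ) + 1 ≤ ι u := by omega
        exact_mod_cast this
      rw [min_eq_left (a := (1 : ℚ)) (b := (ι u : ℚ) / ((dA G A u : ℚ) + 1))
        (by rw [one_le_div (by positivity)]; linarith)]
      have := mul_le_mul_of_nonneg_left (min_le_left (1 : ℚ) ((ι u : ℚ) / (dA G A u : ℚ))) hd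
      linarith
  linarith

lemma main_induction {V : Type*} [Fintype V] (G : SimpleGraph V) (ι : V → ℤ)
    (h0 : ∀ u, 0 ≤ ι u) (n : ℕ) : ∀ A : Finset V, A.card = n →
    ∃ D : Finset V, (D.card : ℚ) ≤ ∑ u ∈ A, fA G ι A u ∧
      ∀ H : Set V, (D : Set V) ⊆ H → Closed G ι (A : Set V) H → (A : Set V) ⊆ H := by
  induction n with
  | zero =>
    intro A hA
    rw [Finset.card_eq_zero] at hA
    subst hA
    exact ⟨∅, by simp, by simp⟩
  | succ n ih =>
    intro A hA
    have hne : A.Nonempty := Finset.card_pos.mp (by omega)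
    have hsum : ∑ v ∈ A, (gA G ι A v + ∑ u ∈ A.erase v, fA G ι (A.erase v) u)
        ≤ ∑ v ∈ A, ∑ u ∈ A, fA G ι A u := by
      rw [Finset.sum_const, nsmul_eq_mul, Finset.mul_sum, Finset.sum_add_distrib]
      have hsw : ∑ v ∈ A, ∑ u ∈ A.erase v, fA G ι (A.erase v) u
          = ∑ u ∈ A, ∑ v ∈ A.erase u, fA G ι (A.erase v) u := by
        apply Finset.sum_comm'
        intro x y
        simp only [Finset.mem_erase]
        constructor
        · rintro ⟨a, b, c⟩; exact ⟨⟨b.symm, a⟩, c⟩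
        · rintro ⟨⟨b, a⟩, c⟩; exact ⟨a, b.symm, c⟩
      rw [hsw, ← Finset.sum_add_distrib]
      exact Finset.sum_le_sum fun u hu => vertex_bound G ι h0 A u hu
    obtain ⟨v, hv, hle⟩ := Finset.exists_le_of_sum_le hne hsum
    obtain ⟨D, hD, hH⟩ := ih (A.erase v) (by rw [Finset.card_erase_of_mem hv]; omega)
    have step : ∀ H : Set V, (D : Set V) ⊆ H → Closed G ι (A : Set V) H →
        ∀ u ∈ A, u ≠ v → u ∈ H := by
      intro H h1 h2 u hu huv
      apply hH H h1 _ (by simp [hu, huv] : u ∈ ((A.erase v : Finset V) : Set V))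
      intro w hw
      exact h2 w (Finset.mem_of_mem_erase hw)
    by_cases hc : ι v ≤ (dA G A v : ℤ)
    · refine ⟨D, ?_, ?_⟩
      · rw [gA, if_pos hc] at hle; linarith
      · intro H h1 h2 u hu
        by_cases huv : u = v
        · subst huv
          apply h2 u hu
          refine hc.trans ?_
          have : ((A.filter (fun w => G.Adj u w) : Finset V) : Set V) ⊆ H ∩ G.neighborSet u := by
            intro w hw
            simp only [Finset.coe_filter, Set.mem_setOf_eq] at hw
            exact ⟨step H h1 h2 w hw.1 hw.2.ne', hw.2⟩
          have := Set.ncard_le_ncard this (Set.toFinite _)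
          rw [Set.ncard_coe_finset] at this
          exact_mod_cast this
        · exact step H h1 h2 u hu huv
    · refine ⟨insert v D, ?_, ?_⟩
      · rw [gA, if_neg hc] at hle
        have : ((insert v D).card : ℚ) ≤ D.card + 1 := by
          exact_mod_cast Finset.card_insert_le v D
        linarith
      · intro H h1 h2 u hu
        rw [Finset.coe_insert, Set.insert_subset_iff] at h1
        by_cases huv : u = v
        · subst huv; exact h1.1
        · exact step H h1.2 h2 u hu huv

/-- For an `r`-regular graph `G` and an increment `ι` with `0 ≤ ι ≤ d_G` pointwise and
total sum `b`, we have `(r+1)·dyn(G,ι) ≤ b`. -/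
theorem dyn_le_budget_regular {V : Type*} [Fintype V] (G : SimpleGraph V)
    [DecidableRel G.Adj] (r : ℕ) (hreg : G.IsRegularOfDegree r)
    (b : ℤ) (hb : 0 ≤ b) (ι : V → ℤ)
    (hι : ∀ u, 0 ≤ ι u ∧ ι u ≤ (G.degree u : ℤ)) (hsum : (∑ u, ι u) = b) :
    ((r : ℤ) + 1) * (dyn G ι : ℤ) ≤ b := by
  obtain ⟨D, hD, hH⟩ := main_induction G ι (fun u => (hι u).1) _ Finset.univ rfl
  have h1 : dyn G ι ≤ D.card := by
    apply Nat.sInf_le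
    refine ⟨D, ⟨Set.subset_univ _, ?_⟩, Set.ncard_coe_finset D⟩
    intro H h1 _ h3
    have := hH H h1 (by simpa using h3)
    simpa using this
  have hd : ∀ u, dA G Finset.univ u = r := by
    intro u
    rw [← hreg u, ← SimpleGraph.card_neighborFinset_eq_degree, dA]
    congr 1
    ext w
    simp
  have h2 : ∑ u, fA G ι Finset.univ u ≤ (b : ℚ) / ((r : ℚ) + 1) := by
    rw [← hsum, Int.cast_sum, Finset.sum_div]
    refine Finset.sum_le_sum fun u _ => ?_
    rw [fA, hd]
    exact min_le_right _ _
  have h3 : (dyn G ι : ℚ) ≤ (b : ℚ) / ((r : ℚ) + 1) :=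
    le_trans (by exact_mod_cast h1) (hD.trans h2)
  rw [le_div_iff₀ (by positivity)] at h3
  have h4 : ((r : ℚ) + 1) * (dyn G ι : ℚ) ≤ b := by linarith
  exact_mod_cast h4
end
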